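/- Suppose φ_d(x) ≥ m for all x ∈ ℝ^d and all sufficiently large d, let κ_{d,i} = E_{π_d}[q_i^T A^{1/2}(x − A^{-1}b)] and γ_{d,i} = E_{π_d}[(q_i^T A^{1/2}(x − A^{-1}b))²] where q_i is a normalized eigenvector of A for λ_i². If lim_{d→∞} Σ_{i=1}^d (T_{1i}² + T_{3i}²) = 0, then lim_{d→∞} Σ_{i=1}^d (κ_{d,i} T_{1i} + T_{3i}(γ_{d,i} − 1)) = 0 and lim_{d→∞} Σ_{i=1}^d (κ_{d,i} T_{1i} + T_{3i}(γ_{d,i} − 1))² = 0; that is, μ_ng = μ and σ_ng² = σ², so the limiting expected acceptance rate for the non-Gaussian target equals that for the Gaussian target. -/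

import Mathlib

open MeasureTheory ProbabilityTheory Matrix Filter
open scoped Topology

noncomputable section MHSetup

/-- The standard Gaussian measure `N(0, I)` on `ℝ^d`. -/
def stdGaussian (d : ℕ) : Measure (Fin d → ℝ) := Measure.pi fun _ => gaussianReal 0 1

/-- `T_{1i} = r̂_i λ_i (r_i g_i - g̃_i)`. -/
def T1fun (lam lamt Gi rhat : ℝ) : ℝ :=
  rhat * lam * (((lam ^ 2 - lamt ^ 2) / lam ^ 2) * (1 - Gi ^ 2) - (1 - Gi))

/-- `T_{3i} = ½ r_i g_i`. -/
def T3fun (lam lamt Gi : ℝ) : ℝ :=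
  ((lam ^ 2 - lamt ^ 2) / lam ^ 2) * (1 - Gi ^ 2) / 2

/-- The equilibrium reference state `x = A⁻¹b + Rξ` with `R Rᵀ = A⁻¹`, so that
`x ~ π̃_d = N(A⁻¹b, A⁻¹)` and `e^{-φ_d}` reweights it to `π_d`. -/
def xeq {d : ℕ} (A : Matrix (Fin d) (Fin d) ℝ) (b : Fin d → ℝ)
    (R : Matrix (Fin d) (Fin d) ℝ) (ξ : Fin d → ℝ) : Fin d → ℝ :=
  A⁻¹.mulVec b + R.mulVec ξ

/-- The `i`-th column of `Q`: a normalized eigenvector of `A` for `λ_i²`. -/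
def qcol {d : ℕ} (Q : Matrix (Fin d) (Fin d) ℝ) (i : Fin d) : Fin d → ℝ :=
  fun j => Q j i

/-- `κ_{d,i} = E_{π_d}[q_iᵀ A^{1/2}(x - A⁻¹b)]`. -/
def kappaI {d : ℕ} (A : Matrix (Fin d) (Fin d) ℝ) (b : Fin d → ℝ)
    (R Ah : Matrix (Fin d) (Fin d) ℝ) (φ : (Fin d → ℝ) → ℝ) (qdir : Fin d → ℝ) : ℝ :=
  ∫ ξ, (qdir ⬝ᵥ Ah.mulVec (xeq A b R ξ - A⁻¹.mulVec b))
      * Real.exp (-(φ (xeq A b R ξ))) ∂stdGaussian d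

/-- `γ_{d,i} = E_{π_d}[(q_iᵀ A^{1/2}(x - A⁻¹b))²]`. -/
def gammaI {d : ℕ} (A : Matrix (Fin d) (Fin d) ℝ) (b : Fin d → ℝ)
    (R Ah : Matrix (Fin d) (Fin d) ℝ) (φ : (Fin d → ℝ) → ℝ) (qdir : Fin d → ℝ) : ℝ :=
  ∫ ξ, (qdir ⬝ᵥ Ah.mulVec (xeq A b R ξ - A⁻¹.mulVec b)) ^ 2
      * Real.exp (-(φ (xeq A b R ξ))) ∂stdGaussian d

end MHSetup

lemma memLp_linear_add_sq_gaussianReal (a c : ℝ) :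
    MemLp (fun x : ℝ => a * x + c * (x ^ 2 - 1)) 2 (gaussianReal 0 1) := by
  have hid : MemLp (fun x : ℝ => x) 2 (gaussianReal 0 1) :=
    memLp_id_gaussianReal' 2 (by norm_num)
  have hsq : MemLp (fun x : ℝ => x ^ 2) 2 (gaussianReal 0 1) := by
    have h4 : MemLp (fun x : ℝ => x) 4 (gaussianReal 0 1) :=
      memLp_id_gaussianReal' 4 (by norm_num)
    have : ENNReal.HolderTriple 4 4 2 := ⟨by
      rw [← two_mul, show (4 : ENNReal) = 2 * 2 by norm_num,
        ENNReal.mul_inv (by simp) (by simp), ← mul_assoc,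
        ENNReal.mul_inv_cancel (by simp) (by simp), one_mul]⟩
    simp_rw [sq]
    exact h4.mul (r := 2) h4
  exact (hid.const_mul a).add ((hsq.sub (memLp_const 1)).const_mul c)

lemma integral_sq_gaussianReal : ∫ x : ℝ, x ^ 2 ∂gaussianReal 0 1 = 1 := by
  have h := variance_fun_id_gaussianReal (μ := 0) (v := 1)
  rw [variance_of_integral_eq_zero (by fun_prop) (by simp)] at h
  simpa using h

lemma integral_linear_add_sq_gaussianReal (a c : ℝ) :
    ∫ x : ℝ, (a * x + c * (x ^ 2 - 1)) ∂gaussianReal 0 1 = 0 := by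
  have h1 : Integrable (fun x : ℝ => x) (gaussianReal 0 1) :=
    (memLp_id_gaussianReal' 1 (by norm_num)).integrable le_rfl
  have h2 : Integrable (fun x : ℝ => x ^ 2) (gaussianReal 0 1) :=
    (memLp_id_gaussianReal' 2 (by norm_num)).integrable_sq
  have h3 : Integrable (fun x : ℝ => c * (x ^ 2 - 1)) (gaussianReal 0 1) :=
    (h2.sub (integrable_const 1)).const_mul c
  rw [integral_add (h1.const_mul a) h3, integral_const_mul, integral_const_mul,
    integral_sub h2 (integrable_const 1),
    integral_sq_gaussianReal]
  simp

lemma exists_variance_linear_add_sq_le :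
    ∃ C : ℝ, ∀ a c : ℝ,
      Var[fun x : ℝ => a * x + c * (x ^ 2 - 1); gaussianReal 0 1] ≤ C * (a ^ 2 + c ^ 2) := by
  have h1 : Integrable (fun x : ℝ => x ^ 2) (gaussianReal 0 1) :=
    (memLp_id_gaussianReal' 2 (by norm_num)).integrable_sq
  have h2 : Integrable (fun x : ℝ => (x ^ 2 - 1) ^ 2) (gaussianReal 0 1) := by
    simpa using (memLp_linear_add_sq_gaussianReal 0 1).integrable_sq
  refine ⟨∫ x : ℝ, (x ^ 2 + (x ^ 2 - 1) ^ 2) ∂gaussianReal 0 1, fun a c => ?_⟩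
  rw [variance_of_integral_eq_zero (by fun_prop) (integral_linear_add_sq_gaussianReal a c),
    ← integral_mul_const]
  refine integral_mono (memLp_linear_add_sq_gaussianReal a c).integrable_sq
    ((h1.add h2).mul_const _) fun x => ?_
  simp only
  nlinarith [sq_nonneg (a * (x ^ 2 - 1) - c * x)]

lemma measurePreserving_mulVec_stdGaussian {d : ℕ} {O : Matrix (Fin d) (Fin d) ℝ}
    (hO : Oᵀ * O = 1) :
    MeasurePreserving O.mulVec (_root_.stdGaussian d) (_root_.stdGaussian d) := by
  have hnorm (x : EuclideanSpace ℝ (Fin d)) : ‖O.toEuclideanLin x‖ = ‖x‖ := by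
    rw [← sq_eq_sq₀ (norm_nonneg _) (norm_nonneg _), ← real_inner_self_eq_norm_sq,
      ← real_inner_self_eq_norm_sq, EuclideanSpace.inner_eq_star_dotProduct,
      EuclideanSpace.inner_eq_star_dotProduct]
    simp [dotProduct_mulVec, ← mulVec_transpose, mulVec_mulVec, hO]
  let e : EuclideanSpace ℝ (Fin d) ≃ₗᵢ[ℝ] EuclideanSpace ℝ (Fin d) :=
    LinearIsometry.toLinearIsometryEquiv ⟨O.toEuclideanLin, hnorm⟩ rfl
  have hmeas : Measurable O.mulVec := by
    have : Continuous O.mulVec := by fun_prop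
    exact this.measurable
  refine ⟨hmeas, ?_⟩
  have hcomp : O.mulVec = WithLp.ofLp ∘ e ∘ WithLp.toLp 2 := rfl
  have hid : (WithLp.ofLp ∘ WithLp.toLp 2 : (Fin d → ℝ) → Fin d → ℝ) = id := rfl
  rw [hcomp, ← Measure.map_map (by fun_prop) (by fun_prop), ← Measure.map_map (by fun_prop)
    (by fun_prop), _root_.stdGaussian, map_pi_eq_stdGaussian, stdGaussian_map,
    ← map_pi_eq_stdGaussian, Measure.map_map (by fun_prop) (by fun_prop), hid, Measure.map_id]

instance (d : ℕ) : IsProbabilityMeasure (_root_.stdGaussian d) := by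
  unfold _root_.stdGaussian; infer_instance

/-- Cauchy–Schwarz against a probability density bounded by `K`. -/
lemma sq_integral_mul_density_le {Ω : Type*} [MeasurableSpace Ω] {μ : Measure Ω}
    [IsFiniteMeasure μ] {S ρ : Ω → ℝ} {K : ℝ} (hS : MemLp S 2 μ) (hρ : Measurable ρ)
    (hρ0 : ∀ x, 0 ≤ ρ x) (hρK : ∀ x, ρ x ≤ K) (hρ1 : ∫ x, ρ x ∂μ = 1) :
    (∫ x, S x * ρ x ∂μ) ^ 2 ≤ K * ∫ x, S x ^ 2 ∂μ := by
  have hb : ∀ᵐ x ∂μ, ‖ρ x‖ ≤ K := ae_of_all _ fun x => by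
    rw [Real.norm_of_nonneg (hρ0 x)]; exact hρK x
  have h0 : Integrable ρ μ := Integrable.of_bound hρ.aestronglyMeasurable K hb
  have h1 : Integrable (fun x => S x * ρ x) μ :=
    (hS.integrable one_le_two).mul_bdd hρ.aestronglyMeasurable hb
  have h2 : Integrable (fun x => S x ^ 2 * ρ x) μ :=
    hS.integrable_sq.mul_bdd hρ.aestronglyMeasurable hb
  set t := ∫ x, S x * ρ x ∂μ with ht
  have hexp : ∫ x, (S x - t) ^ 2 * ρ x ∂μ = ∫ x, S x ^ 2 * ρ x ∂μ - t ^ 2 := by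
    have : (fun x => (S x - t) ^ 2 * ρ x) =
        fun x => S x ^ 2 * ρ x - 2 * t * (S x * ρ x) + t ^ 2 * ρ x := by
      ext x; ring
    have h3 : Integrable (fun x => S x ^ 2 * ρ x - 2 * t * (S x * ρ x)) μ :=
      h2.sub (h1.const_mul _)
    rw [this, integral_add h3 (h0.const_mul _),
      integral_sub h2 (h1.const_mul _), integral_const_mul, integral_const_mul, hρ1, ← ht]
    ring
  have hpos : 0 ≤ ∫ x, (S x - t) ^ 2 * ρ x ∂μ :=
    integral_nonneg fun x => mul_nonneg (sq_nonneg _) (hρ0 x)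
  have hle : ∫ x, S x ^ 2 * ρ x ∂μ ≤ K * ∫ x, S x ^ 2 ∂μ := by
    rw [← integral_const_mul]
    refine integral_mono h2 (hS.integrable_sq.const_mul K) fun x => ?_
    simp only
    nlinarith [mul_le_mul_of_nonneg_left (hρK x) (sq_nonneg (S x))]
  linarith

/-- A constant, independent of the dimension, controlling first and second degree Gaussian
statistics under a change of measure with density at most `K`. -/
lemma exists_sq_sum_tilted_moment_le :
    ∃ C : ℝ, ∀ (d : ℕ) (O : Matrix (Fin d) (Fin d) ℝ) (ρ : (Fin d → ℝ) → ℝ) (K : ℝ)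
      (a c : Fin d → ℝ) (s : Finset (Fin d)), Oᵀ * O = 1 → Measurable ρ → (∀ x, 0 ≤ ρ x) →
      (∀ x, ρ x ≤ K) → ∫ x, ρ x ∂_root_.stdGaussian d = 1 →
      (∑ i ∈ s, ((∫ x, O.mulVec x i * ρ x ∂_root_.stdGaussian d) * a i
        + c i * ((∫ x, O.mulVec x i ^ 2 * ρ x ∂_root_.stdGaussian d) - 1))) ^ 2
      ≤ K * (C * ∑ i ∈ s, (a i ^ 2 + c i ^ 2)) := by
  obtain ⟨C, hC⟩ := exists_variance_linear_add_sq_le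
  refine ⟨C, fun d O ρ K a c s hO hρ hρ0 hρK hρ1 => ?_⟩
  have hmp := measurePreserving_mulVec_stdGaussian hO
  have heval (i : Fin d) : MeasurePreserving (Function.eval i) (_root_.stdGaussian d)
      (gaussianReal 0 1) := measurePreserving_eval (fun _ : Fin d => gaussianReal 0 1) i
  have hcoord (i : Fin d) : MeasurePreserving (fun x => O.mulVec x i) (_root_.stdGaussian d)
      (gaussianReal 0 1) := (heval i).comp hmp
  let f (i : Fin d) (y : ℝ) : ℝ := a i * y + c i * (y ^ 2 - 1)
  have hf (i : Fin d) : MemLp (f i) 2 (gaussianReal 0 1) :=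
    memLp_linear_add_sq_gaussianReal (a i) (c i)
  have hfm (i : Fin d) : Measurable (f i) := by fun_prop
  have hfi (i : Fin d) : MemLp (fun y : Fin d → ℝ => f i (y i)) 2 (_root_.stdGaussian d) :=
    (hf i).comp_measurePreserving (heval i)
  have hS : MemLp (fun y : Fin d → ℝ => ∑ i ∈ s, f i (y i)) 2 (_root_.stdGaussian d) :=
    memLp_finsetSum s fun i _ => hfi i
  have hmean : ∫ y, ∑ i ∈ s, f i (y i) ∂_root_.stdGaussian d = 0 := by
    rw [integral_finsetSum s fun i _ => (hfi i).integrable one_le_two]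
    refine Finset.sum_eq_zero fun i _ => ?_
    have h := integral_map (heval i).measurable.aemeasurable
      (hfm i).aestronglyMeasurable (μ := _root_.stdGaussian d)
    rw [(heval i).map_eq, integral_linear_add_sq_gaussianReal] at h
    exact h.symm
  have hsq : ∫ y, (∑ i ∈ s, f i (y i)) ^ 2 ∂_root_.stdGaussian d
      ≤ C * ∑ i ∈ s, (a i ^ 2 + c i ^ 2) := by
    rw [← variance_of_integral_eq_zero hS.aemeasurable hmean, Finset.mul_sum]
    have hind : iIndepFun (fun i (y : Fin d → ℝ) => f i (y i)) (_root_.stdGaussian d) :=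
      iIndepFun_pi fun i => (hfm i).aemeasurable
    have hvar := IndepFun.variance_sum (X := fun i (y : Fin d → ℝ) => f i (y i)) (s := s)
      (fun i _ => hfi i)
      (fun i _ j _ hij => hind.indepFun hij)
    have hfun : (∑ i ∈ s, fun y : Fin d → ℝ => f i (y i)) = fun y => ∑ i ∈ s, f i (y i) := by
      ext y; simp
    rw [hfun] at hvar
    rw [hvar]
    refine Finset.sum_le_sum fun i _ => (le_of_eq ?_).trans (hC (a i) (c i))
    have h := variance_map (X := f i) (hfm i).aemeasurable
      (heval i).measurable.aemeasurable (μ := _root_.stdGaussian d)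
    rw [(heval i).map_eq] at h
    exact h.symm
  have hb : ∀ᵐ x ∂_root_.stdGaussian d, ‖ρ x‖ ≤ K := ae_of_all _ fun x => by
    rw [Real.norm_of_nonneg (hρ0 x)]; exact hρK x
  have h0 : Integrable ρ (_root_.stdGaussian d) :=
    Integrable.of_bound hρ.aestronglyMeasurable K hb
  have hid (i : Fin d) : MemLp (fun x => O.mulVec x i) 2 (_root_.stdGaussian d) :=
    (memLp_id_gaussianReal' 2 (by norm_num)).comp_measurePreserving (hcoord i)
  have h1 (i : Fin d) : Integrable (fun x => O.mulVec x i * ρ x) (_root_.stdGaussian d) :=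
    ((hid i).integrable one_le_two).mul_bdd hρ.aestronglyMeasurable hb
  have h2 (i : Fin d) : Integrable (fun x => O.mulVec x i ^ 2 * ρ x) (_root_.stdGaussian d) :=
    (hid i).integrable_sq.mul_bdd hρ.aestronglyMeasurable hb
  have h3 (i : Fin d) : Integrable (fun x => c i * (O.mulVec x i ^ 2 * ρ x - ρ x))
      (_root_.stdGaussian d) := ((h2 i).sub h0).const_mul _
  have hsum : ∑ i ∈ s, ((∫ x, O.mulVec x i * ρ x ∂_root_.stdGaussian d) * a i
        + c i * ((∫ x, O.mulVec x i ^ 2 * ρ x ∂_root_.stdGaussian d) - 1))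
      = ∫ x, (∑ i ∈ s, f i (O.mulVec x i)) * ρ x ∂_root_.stdGaussian d := by
    have hterm (i : Fin d) : (fun x => f i (O.mulVec x i) * ρ x) = fun x =>
        a i * (O.mulVec x i * ρ x) + c i * (O.mulVec x i ^ 2 * ρ x - ρ x) := by
      ext x; simp only [f]; ring
    simp_rw [Finset.sum_mul]
    rw [integral_finsetSum s fun i _ => by
      rw [hterm]; exact ((h1 i).const_mul _).add (h3 i)]
    refine Finset.sum_congr rfl fun i _ => ?_
    rw [hterm, integral_add ((h1 i).const_mul _) (h3 i),
      integral_const_mul, integral_const_mul, integral_sub (h2 i) h0, hρ1]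
    ring
  have hK : 0 ≤ K := (hρ0 0).trans (hρK 0)
  rw [hsum]
  refine (sq_integral_mul_density_le (hS.comp_measurePreserving hmp) hρ hρ0 hρK hρ1).trans
    (mul_le_mul_of_nonneg_left ?_ hK)
  have h := integral_map (μ := _root_.stdGaussian d) (φ := O.mulVec)
    (f := fun y => (∑ i ∈ s, f i (y i)) ^ 2) hmp.measurable.aemeasurable
    (Measurable.aestronglyMeasurable (by fun_prop))
  rw [hmp.map_eq] at h
  exact h.symm.le.trans hsq

/-- Whitening in the eigenbasis: `Qᵀ A^{1/2} R` is orthogonal when `R Rᵀ = A⁻¹`. -/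
lemma transpose_mul_self_whitening {d : ℕ} {A Q R Ah : Matrix (Fin d) (Fin d) ℝ}
    (hQ : Qᵀ * Q = 1) (hR : R * Rᵀ = A⁻¹) (hAh : Ah.PosDef) (hAh2 : Ah * Ah = A) :
    (Qᵀ * Ah * R)ᵀ * (Qᵀ * Ah * R) = 1 := by
  have hsymm : Ahᵀ = Ah := by
    simpa only [conjTranspose_eq_transpose_of_trivial] using hAh.isHermitian.eq
  have hdet : IsUnit Ah.det := hAh.det_pos.ne'.isUnit
  rw [mul_eq_one_comm]
  calc (Qᵀ * Ah * R) * (Qᵀ * Ah * R)ᵀ = Qᵀ * (Ah * (R * Rᵀ) * Ah) * Q := by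
        simp only [transpose_mul, transpose_transpose, hsymm, Matrix.mul_assoc]
    _ = 1 := by
        rw [hR, ← hAh2, Matrix.mul_inv_rev, mul_nonsing_inv_cancel_left _ _ hdet,
          nonsing_inv_mul _ hdet, Matrix.mul_one, hQ]

lemma qcol_dotProduct_xeq {d : ℕ} (A Q R Ah : Matrix (Fin d) (Fin d) ℝ) (b ξ : Fin d → ℝ)
    (i : Fin d) :
    qcol Q i ⬝ᵥ Ah.mulVec (xeq A b R ξ - A⁻¹.mulVec b) = (Qᵀ * Ah * R).mulVec ξ i := by
  rw [xeq, add_sub_cancel_left, Matrix.mul_assoc, ← mulVec_mulVec, ← mulVec_mulVec]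
  rfl

/-- Corollary: equal Gaussian and non-Gaussian limits. If `φ_d ≥ m`
and `lim Σᵢ (T_{1i}² + T_{3i}²) = 0`, then `lim Σᵢ (κ_{d,i}T_{1i} + T_{3i}(γ_{d,i}-1)) = 0`
and `lim Σᵢ (κ_{d,i}T_{1i} + T_{3i}(γ_{d,i}-1))² = 0`; that is, `μ_ng = μ` and
`σ_ng² = σ²`, so the limiting expected acceptance rate for the non-Gaussian target
equals that for the Gaussian target. -/
theorem nongaussian_limits_eq_gaussian_limits
    (A M N : ∀ d : ℕ, Matrix (Fin d) (Fin d) ℝ)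
    (b β : ∀ d : ℕ, Fin d → ℝ)
    (Q R Ah : ∀ d : ℕ, Matrix (Fin d) (Fin d) ℝ)
    (lam lamt Gi mv mtv : ∀ d : ℕ, Fin d → ℝ)
    (φ : ∀ d : ℕ, (Fin d → ℝ) → ℝ)
    (hA : ∀ d, (A d).PosDef)
    (hM : ∀ d, IsUnit (M d))
    (hAcal : ∀ d, (M d - N d).PosDef)
    (hG : ∀ d, ∀ z ∈ spectrum ℂ (((M d)⁻¹ * N d).map (algebraMap ℝ ℂ)), ‖z‖ < 1)
    (hQ : ∀ d, (Q d)ᵀ * Q d = 1)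
    (hdA : ∀ d, ((Q d)ᵀ * A d * Q d).IsDiag)
    (hdM : ∀ d, ((Q d)ᵀ * M d * Q d).IsDiag)
    (hdN : ∀ d, ((Q d)ᵀ * N d * Q d).IsDiag)
    (hlam : ∀ d i, 0 < lam d i ∧ lam d i ^ 2 = ((Q d)ᵀ * A d * Q d) i i)
    (hlamt : ∀ d i, 0 < lamt d i ∧ lamt d i ^ 2 = ((Q d)ᵀ * (M d - N d) * Q d) i i)
    (hGi : ∀ d i, Gi d i = ((Q d)ᵀ * ((M d)⁻¹ * N d) * Q d) i i)
    (hmv : ∀ d i, mv d i = (Q d)ᵀ.mulVec ((A d)⁻¹.mulVec (b d)) i)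
    (hmtv : ∀ d i, mtv d i = (Q d)ᵀ.mulVec ((M d - N d)⁻¹.mulVec (β d)) i)
    (hR : ∀ d, R d * (R d)ᵀ = (A d)⁻¹)
    (hAh : ∀ d, (Ah d).PosDef ∧ Ah d * Ah d = A d)
    (hφmeas : ∀ d, Measurable (φ d))
    (hnorm : ∀ d, ∫ ξ, Real.exp (-(φ d (xeq (A d) (b d) (R d) ξ))) ∂stdGaussian d = 1)
    (m : ℝ) (hlower : ∀ᶠ d in atTop, ∀ x : Fin d → ℝ, m ≤ φ d x)
    (hT13 : Tendsto (fun d : ℕ =>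
        ∑ i, (T1fun (lam d i) (lamt d i) (Gi d i) (mv d i - mtv d i) ^ 2
          + T3fun (lam d i) (lamt d i) (Gi d i) ^ 2)) atTop (𝓝 0)) :
    Tendsto (fun d : ℕ =>
        ∑ i, (kappaI (A d) (b d) (R d) (Ah d) (φ d) (qcol (Q d) i)
              * T1fun (lam d i) (lamt d i) (Gi d i) (mv d i - mtv d i)
            + T3fun (lam d i) (lamt d i) (Gi d i)
              * (gammaI (A d) (b d) (R d) (Ah d) (φ d) (qcol (Q d) i) - 1)))
      atTop (𝓝 0) ∧
    Tendsto (fun d : ℕ =>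
        ∑ i, (kappaI (A d) (b d) (R d) (Ah d) (φ d) (qcol (Q d) i)
              * T1fun (lam d i) (lamt d i) (Gi d i) (mv d i - mtv d i)
            + T3fun (lam d i) (lamt d i) (Gi d i)
              * (gammaI (A d) (b d) (R d) (Ah d) (φ d) (qcol (Q d) i) - 1)) ^ 2)
      atTop (𝓝 0) := by
  obtain ⟨C, hC⟩ := exists_sq_sum_tilted_moment_le
  have hbound : ∀ᶠ d in atTop, ∀ s : Finset (Fin d),
      (∑ i ∈ s, (kappaI (A d) (b d) (R d) (Ah d) (φ d) (qcol (Q d) i)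
              * T1fun (lam d i) (lamt d i) (Gi d i) (mv d i - mtv d i)
            + T3fun (lam d i) (lamt d i) (Gi d i)
              * (gammaI (A d) (b d) (R d) (Ah d) (φ d) (qcol (Q d) i) - 1))) ^ 2
        ≤ Real.exp (-m) * (C * ∑ i ∈ s,
          (T1fun (lam d i) (lamt d i) (Gi d i) (mv d i - mtv d i) ^ 2
            + T3fun (lam d i) (lamt d i) (Gi d i) ^ 2)) := by
    filter_upwards [hlower] with d hd s
    simp only [kappaI, gammaI, qcol_dotProduct_xeq]
    refine hC d _ _ _ _ _ s (transpose_mul_self_whitening (hQ d) (hR d) (hAh d).1 (hAh d).2)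
      ?_ (fun x => (Real.exp_pos _).le) (fun x => Real.exp_le_exp.2 (neg_le_neg (hd _))) (hnorm d)
    have hx : Continuous (xeq (A d) (b d) (R d)) := by unfold xeq; fun_prop
    exact Real.measurable_exp.comp ((hφmeas d).comp hx.measurable).neg
  have hlim : Tendsto (fun d : ℕ => Real.exp (-m) * (C * ∑ i,
      (T1fun (lam d i) (lamt d i) (Gi d i) (mv d i - mtv d i) ^ 2
        + T3fun (lam d i) (lamt d i) (Gi d i) ^ 2))) atTop (𝓝 0) := by
    simpa using (hT13.const_mul C).const_mul (Real.exp (-m))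
  constructor
  · have hsq := squeeze_zero' (Eventually.of_forall fun d => sq_nonneg _)
      (hbound.mono fun d h => h Finset.univ) hlim
    rw [tendsto_zero_iff_abs_tendsto_zero]
    simpa [Real.sqrt_sq_eq_abs, Function.comp_def] using hsq.sqrt
  · refine squeeze_zero' (Eventually.of_forall fun d => Finset.sum_nonneg fun i _ => sq_nonneg _)
      (hbound.mono fun d h => ?_) hlim
    rw [Finset.mul_sum, Finset.mul_sum]
    refine Finset.sum_le_sum fun i _ => ?_
    simpa using h {i}
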